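/- arXiv:1609.05520 — 3 statements merged into one kernel-verified Lean document; each statement's English description precedes it below -/
import Mathlib

section
/- (Ballantine) Let A be an n×n complex matrix all of whose leading principal minors are nonzero. Then there exists an invertible diagonal complex matrix D such that every eigenvalue of DA has positive real part. -/
open Matrix

/-- A polynomial of degree at most `n` grows at most like `(1 + ‖z‖) ^ n`. -/
lemma Polynomial.exists_norm_eval_le {q : Polynomial ℂ} {n : ℕ} (hq : q.natDegree ≤ n) :
    ∃ M : ℝ, 0 < M ∧ ∀ z : ℂ, ‖q.eval z‖ ≤ M * (1 + ‖z‖) ^ n := by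
  refine ⟨1 + ∑ i ∈ Finset.range (n + 1), ‖q.coeff i‖, by positivity, fun z => ?_⟩
  have hsum : ‖q.eval z‖ ≤ (∑ i ∈ Finset.range (n + 1), ‖q.coeff i‖) * (1 + ‖z‖) ^ n := by
    rw [Polynomial.eval_eq_sum_range' (Nat.lt_succ_of_le hq), Finset.sum_mul]
    refine norm_sum_le_of_le _ fun i hi => ?_
    rw [norm_mul, norm_pow]
    have hin : i ≤ n := Nat.lt_succ_iff.mp (Finset.mem_range.mp hi)
    gcongr
    calc ‖z‖ ^ i ≤ (1 + ‖z‖) ^ i := by gcongr; linarith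
      _ ≤ (1 + ‖z‖) ^ n := pow_le_pow_right₀ (by linarith [norm_nonneg z]) hin
  have hpow : 0 ≤ (1 + ‖z‖) ^ n := by positivity
  linarith

/-- A product of linear factors with roots in the open right half-plane grows at least like
`(1 + ‖z‖) ^ n` on the closed left half-plane. -/
lemma Multiset.exists_pow_le_norm_prod_sub (S : Multiset ℂ) (hS : ∀ r ∈ S, 0 < r.re) :
    ∃ C : ℝ, 0 < C ∧ ∀ z : ℂ, z.re ≤ 0 →
      (1 + ‖z‖) ^ S.card ≤ C * ‖(S.map fun r => z - r).prod‖ := by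
  induction S using Multiset.induction_on with
  | empty => exact ⟨1, one_pos, by simp⟩
  | cons r S ih =>
    obtain ⟨C, hC, h⟩ := ih fun x hx => hS x (Multiset.mem_cons_of_mem hx)
    have hr : 0 < r.re := hS r (Multiset.mem_cons_self r S)
    refine ⟨C * (1 + (1 + ‖r‖) / r.re), by positivity, fun z hz => ?_⟩
    have hre : r.re ≤ ‖z - r‖ := by
      have := Complex.abs_re_le_norm (z - r)
      rw [Complex.sub_re] at this
      linarith [neg_le_abs (z.re - r.re)]
    have htri : ‖z‖ - ‖r‖ ≤ ‖z - r‖ := norm_sub_norm_le z r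
    have hdiv : 1 + ‖r‖ ≤ (1 + ‖r‖) / r.re * ‖z - r‖ := by
      rw [div_mul_eq_mul_div, le_div_iff₀ hr]
      gcongr
    have hfac : 1 + ‖z‖ ≤ (1 + (1 + ‖r‖) / r.re) * ‖z - r‖ := by linarith
    rw [Multiset.card_cons, pow_succ, Multiset.map_cons, Multiset.prod_cons, norm_mul]
    calc (1 + ‖z‖) ^ S.card * (1 + ‖z‖)
        ≤ (C * ‖(S.map fun r => z - r).prod‖) * ((1 + (1 + ‖r‖) / r.re) * ‖z - r‖) := by
          gcongr
          exact h z hz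
      _ = _ := by ring

/-- If all roots of `p` lie in the open right half-plane, then so do those of `X * p + s * q`
for a suitable nonzero `s`. -/
lemma Polynomial.exists_ne_zero_forall_re_pos {p q : Polynomial ℂ} (hp : p.Monic)
    (hroots : ∀ z, p.IsRoot z → 0 < z.re) (hdeg : q.natDegree ≤ p.natDegree)
    (hq : q.eval 0 ≠ 0) :
    ∃ s : ℂ, s ≠ 0 ∧ ∀ z, (Polynomial.X * p + Polynomial.C s * q).IsRoot z → 0 < z.re := by
  have hp0 : p.eval 0 ≠ 0 := fun h => by simpa using hroots 0 h
  obtain ⟨M, hM, hqM⟩ := Polynomial.exists_norm_eval_le hdeg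
  obtain ⟨C, hC, hpC⟩ := p.roots.exists_pow_le_norm_prod_sub fun r hr =>
    hroots r (Polynomial.isRoot_of_mem_roots hr)
  have hsplit := IsAlgClosed.splits p
  have hlow : ∀ z : ℂ, z.re ≤ 0 → (1 + ‖z‖) ^ p.natDegree ≤ C * ‖p.eval z‖ := fun z hz => by
    have := hpC z hz
    rw [← hsplit.natDegree_eq_card_roots] at this
    rwa [hsplit.eval_eq_prod_roots_of_monic hp]
  set w : ℂ := p.eval 0 / q.eval 0 with hw
  have hw0 : w ≠ 0 := div_ne_zero hp0 hq
  have hcont : ContinuousAt (fun z => (w * (q.eval z / p.eval z)).re) 0 := by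
    have : ContinuousAt (fun z => w * (q.eval z / p.eval z)) 0 :=
      continuousAt_const.mul (q.continuous.continuousAt.div p.continuous.continuousAt hp0)
    exact Complex.continuous_re.continuousAt.comp this
  have hev : ∀ᶠ z in nhds (0 : ℂ), 0 < (w * (q.eval z / p.eval z)).re := by
    refine hcont.eventually (lt_mem_nhds ?_)
    have : w * (q.eval 0 / p.eval 0) = 1 := by rw [hw]; field_simp
    simp [this]
  obtain ⟨δ, hδ, hball⟩ := Metric.eventually_nhds_iff.mp hev
  have hK : 0 < ‖w‖ * (M * C) := by have := norm_pos_iff.mpr hw0; positivity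
  set ε : ℝ := δ / (2 * (‖w‖ * (M * C))) with hε
  have hεpos : 0 < ε := by positivity
  refine ⟨-(ε * w), neg_ne_zero.mpr (mul_ne_zero (by exact_mod_cast hεpos.ne') hw0),
    fun z hz => ?_⟩
  by_contra! hzre
  have hpz : p.eval z ≠ 0 := fun h => (hroots z h).not_ge hzre
  have hz' : z = ε * (w * (q.eval z / p.eval z)) := by
    simp only [Polynomial.IsRoot, Polynomial.eval_add, Polynomial.eval_mul, Polynomial.eval_X,
      Polynomial.eval_C] at hz
    field_simp
    linear_combination hz
  have hratio : ‖q.eval z / p.eval z‖ ≤ M * C := by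
    rw [norm_div, div_le_iff₀ (norm_pos_iff.mpr hpz)]
    calc ‖q.eval z‖ ≤ M * (1 + ‖z‖) ^ p.natDegree := hqM z
      _ ≤ M * (C * ‖p.eval z‖) := by gcongr; exact hlow z hzre
      _ = _ := by ring
  have hnorm : ‖z‖ < δ := by
    calc ‖z‖ = ε * (‖w‖ * ‖q.eval z / p.eval z‖) := by
          conv_lhs => rw [hz']
          rw [norm_mul, norm_mul, Complex.norm_real, Real.norm_of_nonneg hεpos.le]
      _ ≤ ε * (‖w‖ * (M * C)) := by gcongr
      _ = δ / 2 := by rw [hε]; field_simp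
      _ < δ := half_lt_self hδ
  have hpos := hball (y := z) (by simpa using hnorm)
  have hre : z.re = ε * (w * (q.eval z / p.eval z)).re := by
    conv_lhs => rw [hz']
    exact Complex.re_ofReal_mul _ _
  exact absurd (hre ▸ mul_pos hεpos hpos) hzre.not_gt

namespace Matrix

variable {n : ℕ}

/-- The characteristic polynomial of `diagonal (Fin.snoc d s) * A` is affine in `s`. -/
lemma charpoly_diagonal_snoc_mul (A : Matrix (Fin (n + 1)) (Fin (n + 1)) ℂ) (d : Fin n → ℂ) :
    ∃ Q : Polynomial ℂ, ∀ s : ℂ,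
      (diagonal (Fin.snoc d s : Fin (n + 1) → ℂ) * A).charpoly =
        (diagonal (Fin.snoc d 0 : Fin (n + 1) → ℂ) * A).charpoly + Polynomial.C s * Q := by
  set N := (diagonal (Fin.snoc d 0 : Fin (n + 1) → ℂ) * A).charmatrix with hN
  refine ⟨(N.updateRow (Fin.last n) fun j => -Polynomial.C (A (Fin.last n) j)).det, fun s => ?_⟩
  have hrow : (diagonal (Fin.snoc d s : Fin (n + 1) → ℂ) * A).charmatrix =
      N.updateRow (Fin.last n)
        (N (Fin.last n) + Polynomial.C s • fun j => -Polynomial.C (A (Fin.last n) j)) := by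
    ext1 i j
    induction i using Fin.lastCases with
    | last => simp [hN, charmatrix_apply, diagonal_mul, sub_eq_add_neg]
    | cast i => simp [hN, charmatrix_apply, diagonal_mul, updateRow_apply, Fin.castSucc_ne_last]
  rw [charpoly, hrow, det_updateRow_add, det_updateRow_smul, updateRow_eq_self, charpoly]

lemma charpoly_diagonal_snoc_zero_mul (A : Matrix (Fin (n + 1)) (Fin (n + 1)) ℂ)
    (d : Fin n → ℂ) :
    (diagonal (Fin.snoc d 0 : Fin (n + 1) → ℂ) * A).charpoly =
      Polynomial.X * (diagonal d * A.submatrix Fin.castSucc Fin.castSucc).charpoly := by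
  rw [charpoly, det_succ_row _ (Fin.last n), Finset.sum_eq_single (Fin.last n)]
  · have hsub : (diagonal (Fin.snoc d 0 : Fin (n + 1) → ℂ) * A).charmatrix.submatrix
        (Fin.last n).succAbove (Fin.last n).succAbove =
        (diagonal d * A.submatrix Fin.castSucc Fin.castSucc).charmatrix := by
      ext1 i j
      simp [charmatrix_apply, diagonal_mul, diagonal_apply]
    rw [hsub, charpoly]
    simp [diagonal_mul, ← two_mul]
  · intro j _ hj
    simp [diagonal_mul, hj.symm]
  · simp

/-- A stabilizing diagonal matrix for a leading principal block extends to one for the whole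
invertible matrix. -/
lemma exists_diagonal_snoc_stabilization (A : Matrix (Fin (n + 1)) (Fin (n + 1)) ℂ)
    (hA : A.det ≠ 0) {d : Fin n → ℂ} (hd : ∀ i, d i ≠ 0)
    (hroots : ∀ μ : ℂ, (diagonal d * A.submatrix Fin.castSucc Fin.castSucc).charpoly.IsRoot μ →
      0 < μ.re) :
    ∃ s : ℂ, s ≠ 0 ∧ ∀ μ : ℂ,
      (diagonal (Fin.snoc d s : Fin (n + 1) → ℂ) * A).charpoly.IsRoot μ → 0 < μ.re := by
  obtain ⟨Q, hQ⟩ := charpoly_diagonal_snoc_mul A d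
  have hQ1 : Q = (diagonal (Fin.snoc d 1 : Fin (n + 1) → ℂ) * A).charpoly -
      (diagonal (Fin.snoc d 0 : Fin (n + 1) → ℂ) * A).charpoly := by
    rw [hQ 1]; simp
  have hQ0 : Q.eval 0 ≠ 0 := by
    rw [hQ1, charpoly_diagonal_snoc_zero_mul]
    have hdet : (diagonal (Fin.snoc d 1 : Fin (n + 1) → ℂ) * A).det ≠ 0 := by
      rw [det_mul, det_diagonal, Fin.prod_univ_castSucc]
      simpa [Finset.prod_eq_zero_iff, hd] using hA
    rw [det_eq_sign_charpoly_coeff, Polynomial.coeff_zero_eq_eval_zero] at hdet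
    simpa using right_ne_zero_of_mul hdet
  have hdeg : Q.natDegree ≤ n := by
    have hne : Q ≠ 0 := fun h => hQ0 (by simp [h])
    rw [← Nat.lt_succ_iff, Polynomial.natDegree_lt_iff_degree_lt hne, hQ1]
    have := Polynomial.degree_sub_lt_left
      (p := (diagonal (Fin.snoc d 1 : Fin (n + 1) → ℂ) * A).charpoly)
      (q := (diagonal (Fin.snoc d 0 : Fin (n + 1) → ℂ) * A).charpoly)
      (by simp only [charpoly_degree_eq_dim]) (charpoly_monic _).ne_zero
      (by simp only [(charpoly_monic _).leadingCoeff])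
    rw [charpoly_degree_eq_dim, Fintype.card_fin] at this
    exact this
  obtain ⟨s, hs, h⟩ := Polynomial.exists_ne_zero_forall_re_pos (charpoly_monic _) hroots
    (by simpa [charpoly_natDegree_eq_dim] using hdeg) hQ0
  refine ⟨s, hs, fun μ hμ => h μ ?_⟩
  rwa [← charpoly_diagonal_snoc_zero_mul, ← hQ s]

end Matrix

/-- Ballantine: If all leading principal minors of `A` are nonzero, then there
exists an invertible diagonal complex matrix `D` such that every eigenvalue of `D·A` has
positive real part. -/
theorem ballantine_diagonal_stabilization {n : ℕ} (A : Matrix (Fin n) (Fin n) ℂ)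
    (hminor : ∀ k : ℕ, (hk : k ≤ n) →
      (A.submatrix (Fin.castLE hk) (Fin.castLE hk)).det ≠ 0) :
    ∃ d : Fin n → ℂ, (∀ i, d i ≠ 0) ∧
      ∀ μ : ℂ, (Matrix.diagonal d * A).charpoly.IsRoot μ → 0 < μ.re := by
  induction n with
  | zero => exact ⟨0, fun i => i.elim0, fun μ hμ => by simp [Matrix.charpoly] at hμ⟩
  | succ n ih =>
    obtain ⟨d, hd, hroots⟩ := ih (A.submatrix Fin.castSucc Fin.castSucc)
      fun k hk => hminor k (hk.trans n.le_succ)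
    obtain ⟨s, hs, h⟩ := Matrix.exists_diagonal_snoc_stabilization A
      (hminor (n + 1) le_rfl) hd hroots
    refine ⟨Fin.snoc d s, fun i => ?_, h⟩
    induction i using Fin.lastCases with
    | last => simpa using hs
    | cast i => simpa using hd i
end

section
/- Let G be a bidirectional (simple) graph on the vertex set {1,…,n} with n ≥ 3 that is 2-rooted with roots r₁, r₂, and let ξ ∈ ℂⁿ have pairwise distinct entries. Then there exists an n×n complex matrix L supported on G (i.e. L(i,j) = 0 whenever i ≠ j and {i,j} is not an edge of G, and each diagonal entry equals the negated sum of the off-diagonal entries of its row, so L·𝟙 = 0) such that L·ξ = 0 and rank(L) = n − 2. -/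
open Matrix

/-- A vertex `v` is 2-reachable from `{r₁, r₂}` in the bidirectional graph `G` if, after
deleting any single vertex `u ≠ v`, `v` remains reachable from some remaining root in the
induced subgraph. -/
def TwoReachableFrom {n : ℕ} (G : SimpleGraph (Fin n)) (r₁ r₂ v : Fin n) : Prop :=
  ∀ u : Fin n, (huv : u ≠ v) →
    ∃ r : Fin n, (r = r₁ ∨ r = r₂) ∧ ∃ hr : r ≠ u,
      (G.induce {w : Fin n | w ≠ u}).Reachable ⟨r, hr⟩ ⟨v, huv.symm⟩

/-- `G` is 2-rooted with roots `r₁ ≠ r₂` if every other vertex is 2-reachable from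
`{r₁, r₂}`. -/
def IsTwoRooted {n : ℕ} (G : SimpleGraph (Fin n)) (r₁ r₂ : Fin n) : Prop :=
  r₁ ≠ r₂ ∧ ∀ v : Fin n, v ≠ r₁ → v ≠ r₂ → TwoReachableFrom G r₁ r₂ v

/-- An ear of `G` attached to `S`: a path `p 0, …, p (k + 1)` in `G` whose distinct endpoints lie
in `S` and whose interior vertices `p 1, …, p k` (with `1 ≤ k`) lie outside `S`. -/
structure IsEar {V : Type*} (G : SimpleGraph V) (S : Set V) (k : ℕ) (p : ℕ → V) : Prop where
  one_le : 1 ≤ k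
  injOn : Set.InjOn p (Set.Iic (k + 1))
  adj : ∀ i ≤ k, G.Adj (p i) (p (i + 1))
  start_mem : p 0 ∈ S
  end_mem : p (k + 1) ∈ S
  notMem : ∀ i, 1 ≤ i → i ≤ k → p i ∉ S

/-- Two distinct vertices of `S` attached to the same component of the complement of `S` are
joined by an ear. -/
theorem exists_isEar_of_reachable {V : Type*} {G : SimpleGraph V} {S : Set V} {a b : V}
    {c d : (Sᶜ : Set V)} (ha : a ∈ S) (hb : b ∈ S) (hab : a ≠ b) (hac : G.Adj a c)
    (hbd : G.Adj b d) (hcd : (G.induce Sᶜ).Reachable c d) :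
    ∃ k p, IsEar G S k p := by
  classical
  obtain ⟨q, hq⟩ := hcd.exists_isPath
  have hS : ∀ i, (q.getVert i : V) ∉ S := fun i => (q.getVert i).2
  refine ⟨q.length + 1, fun i => if i = 0 then a else
    if i ≤ q.length + 1 then (q.getVert (i - 1) : V) else b, by omega, ?_, ?_, ?_, ?_, ?_⟩
  · intro i hi j hj hij
    simp only [Set.mem_Iic] at hi hj
    have inj : ∀ i j : ℕ, i ≤ q.length → j ≤ q.length →
        (q.getVert i : V) = q.getVert j → i = j := fun i j hi hj h =>
      hq.getVert_injOn hi hj (Subtype.ext h)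
    have h := inj (i - 1) (j - 1)
    have hSi := hS (i - 1)
    have hSj := hS (j - 1)
    dsimp only at hij
    split_ifs at hij <;> grind
  · intro i hi
    rcases Nat.eq_zero_or_pos i with rfl | hpos
    · simpa using hac
    · obtain ⟨j, rfl⟩ : ∃ j, i = j + 1 := ⟨i - 1, by omega⟩
      rcases Nat.lt_or_ge j q.length with hj | hj
      · have := q.adj_getVert_succ hj
        have h1 : j + 1 ≤ q.length := hj
        simpa [hi, h1] using this
      · have hj' : j = q.length := by omega
        subst hj'
        simpa using hbd.symm
  · simpa using ha
  · simpa using hb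
  · intro i h1 h2
    have h0 : i ≠ 0 := by omega
    simpa [h0, h2] using hS (i - 1)

/-- In a 2-rooted graph, every proper vertex set containing both roots has an ear. -/
theorem IsTwoRooted.exists_isEar {n : ℕ} {G : SimpleGraph (Fin n)} {r₁ r₂ : Fin n}
    (hroot : IsTwoRooted G r₁ r₂) {S : Set (Fin n)} (h₁ : r₁ ∈ S) (h₂ : r₂ ∈ S) {v : Fin n}
    (hv : v ∉ S) : ∃ k p, IsEar G S k p := by
  by_contra hno
  let c₀ : (Sᶜ : Set (Fin n)) := ⟨v, hv⟩
  let A : Set (Fin n) :=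
    {a | a ∈ S ∧ ∃ c : (Sᶜ : Set (Fin n)), G.Adj a c ∧ (G.induce Sᶜ).Reachable c₀ c}
  have hA : A.Subsingleton := by
    rintro a ⟨ha, c, hac, hc⟩ b ⟨hb, d, hbd, hd⟩
    by_contra hab
    exact hno (exists_isEar_of_reachable ha hb hab hac hbd (hc.symm.trans hd))
  obtain ⟨u, huS, hu⟩ : ∃ u ∈ S, ∀ a ∈ A, a = u := by
    rcases A.eq_empty_or_nonempty with h | ⟨u, hu⟩
    · exact ⟨r₁, h₁, by simp [h]⟩
    · exact ⟨u, hu.1, fun a ha => hA ha hu⟩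
  have huv : u ≠ v := fun h => hv (h ▸ huS)
  obtain ⟨r, hr, hru, ⟨w⟩⟩ :=
    hroot.2 v (fun h => hv (h ▸ h₁)) (fun h => hv (h ▸ h₂)) u huv
  have key : ∀ (x y : {w : Fin n | w ≠ u}), (G.induce {w : Fin n | w ≠ u}).Walk x y →
      (∃ hx : (x : Fin n) ∈ Sᶜ, (G.induce Sᶜ).Reachable c₀ ⟨x, hx⟩) → (y : Fin n) ∉ S := by
    intro x y w
    induction w with
    | nil => exact fun ⟨hx, _⟩ => hx
    | @cons x z y hxz _ ih =>
      rintro ⟨hx, hreach⟩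
      have hadj : G.Adj x z := hxz
      have hz : (z : Fin n) ∈ Sᶜ := fun hzS =>
        z.2 (hu z ⟨hzS, ⟨x, hx⟩, hadj.symm, hreach⟩)
      refine ih ⟨hz, hreach.trans (SimpleGraph.Adj.reachable ?_)⟩
      exact hadj
  refine key _ _ w.reverse ⟨hv, .refl _⟩ ?_
  rcases hr with rfl | rfl <;> assumption

/-- The linear form in `x` that vanishes iff `(ξ v, x v)` lies on the line through `(ξ a, x a)` and
`(ξ b, x b)`. -/
def collinearForm {V : Type*} (ξ : V → ℂ) (v a b : V) (x : V → ℂ) : ℂ :=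
  (ξ b - ξ a) * x v - (ξ b - ξ v) * x a - (ξ v - ξ a) * x b

/-- If consecutive triples of a path are collinear and `x` vanishes at both ends of the path,
then `x` vanishes along the whole path. -/
theorem eq_zero_of_collinearForm {V : Type*} {ξ x : V → ℂ} (hξ : Function.Injective ξ) {k : ℕ}
    {p : ℕ → V} (hp : Set.InjOn p (Set.Iic (k + 1)))
    (hcol : ∀ i, 1 ≤ i → i ≤ k → collinearForm ξ (p i) (p (i - 1)) (p (i + 1)) x = 0)
    (h0 : x (p 0) = 0) (hk : x (p (k + 1)) = 0) : ∀ i ≤ k + 1, x (p i) = 0 := by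
  have hne : ∀ i j, i ≤ k + 1 → j ≤ k + 1 → i ≠ j → ξ (p i) - ξ (p j) ≠ 0 :=
    fun i j hi hj hij h => hij (hp hi hj (hξ (sub_eq_zero.mp h)))
  have h10 := hne 1 0 (by omega) (by omega) (by omega)
  set c : ℂ := x (p 1) / (ξ (p 1) - ξ (p 0)) with hc
  have key : ∀ i, (i ≤ k + 1 → x (p i) = c * (ξ (p i) - ξ (p 0))) ∧
      (i + 1 ≤ k + 1 → x (p (i + 1)) = c * (ξ (p (i + 1)) - ξ (p 0))) := by
    intro i
    induction i with
    | zero =>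
      refine ⟨fun _ => by simp [h0], fun _ => ?_⟩
      rw [hc, zero_add, div_mul_cancel₀ _ h10]
    | succ i ih =>
      refine ⟨ih.2, fun hi => ?_⟩
      have e0 := ih.1 (by omega)
      have e1 := ih.2 (by omega)
      have e := hcol (i + 1) (by omega) (by omega)
      simp only [collinearForm, Nat.add_sub_cancel] at e
      apply mul_left_cancel₀ (hne (i + 1) i (by omega) (by omega) (by omega))
      rw [e0, e1] at e
      linear_combination -e
  have hc0 : c = 0 := by
    have := (key (k + 1)).1 le_rfl
    rw [hk] at this
    exact (mul_eq_zero.mp this.symm).resolve_right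
      (hne (k + 1) 0 le_rfl (by omega) (by omega))
  intro i hi
  rw [(key i).1 hi, hc0, zero_mul]

/-- The functions `l` and `h` assign two neighbours to each vertex of `S` other than the
roots, in such a way that the resulting collinearity constraints force a vector vanishing at the
roots to vanish on `S`. -/
def Determines {V : Type*} (G : SimpleGraph V) (ξ : V → ℂ) (r₁ r₂ : V) (S : Set V)
    (l h : V → V) : Prop :=
  (∀ v ∈ S, v ≠ r₁ → v ≠ r₂ → G.Adj v (l v) ∧ G.Adj v (h v)) ∧
    ∀ x : V → ℂ, (∀ v ∈ S, v ≠ r₁ → v ≠ r₂ → collinearForm ξ v (l v) (h v) x = 0) →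
      x r₁ = 0 → x r₂ = 0 → ∀ v ∈ S, x v = 0

/-- Determining neighbour assignments extend along ears. -/
theorem Determines.exists_of_isEar {V : Type*} {G : SimpleGraph V} {ξ : V → ℂ}
    (hξ : Function.Injective ξ) {r₁ r₂ : V} {S : Set V} {l h : V → V} (h₁ : r₁ ∈ S) (h₂ : r₂ ∈ S)
    (hdet : Determines G ξ r₁ r₂ S l h) {k : ℕ} {p : ℕ → V} (hp : IsEar G S k p) :
    ∃ l' h', Determines G ξ r₁ r₂ (S ∪ p '' Set.Icc 1 k) l' h' := by
  classical
  let idx : V → ℕ := Function.invFunOn p (Set.Icc 1 k)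
  have hidx : ∀ i, 1 ≤ i → i ≤ k → idx (p i) = i := fun i h1 h2 =>
    (hp.injOn.mono fun j hj => Nat.le_succ_of_le hj.2).leftInvOn_invFunOn ⟨h1, h2⟩
  let l' : V → V := fun v => if v ∈ S then l v else p (idx v - 1)
  let h' : V → V := fun v => if v ∈ S then h v else p (idx v + 1)
  have hlS : ∀ v ∈ S, l' v = l v := fun v hv => if_pos hv
  have hhS : ∀ v ∈ S, h' v = h v := fun v hv => if_pos hv
  have hlp : ∀ i, 1 ≤ i → i ≤ k → l' (p i) = p (i - 1) := fun i h1 h2 => by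
    simp only [l', if_neg (hp.notMem i h1 h2), hidx i h1 h2]
  have hhp : ∀ i, 1 ≤ i → i ≤ k → h' (p i) = p (i + 1) := fun i h1 h2 => by
    simp only [h', if_neg (hp.notMem i h1 h2), hidx i h1 h2]
  refine ⟨l', h', ?_, ?_⟩
  · rintro v (hv | ⟨i, ⟨h1, h2⟩, rfl⟩) hv1 hv2
    · rw [hlS v hv, hhS v hv]
      exact hdet.1 v hv hv1 hv2
    · rw [hlp i h1 h2, hhp i h1 h2]
      have hadj := hp.adj (i - 1) (by omega)
      rw [Nat.sub_add_cancel h1] at hadj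
      exact ⟨hadj.symm, hp.adj i h2⟩
  · intro x hx hx1 hx2
    have hxS : ∀ v ∈ S, x v = 0 := hdet.2 x (fun v hv hv1 hv2 => by
      simpa only [hlS v hv, hhS v hv] using hx v (.inl hv) hv1 hv2) hx1 hx2
    rintro v (hv | ⟨i, ⟨h1, h2⟩, rfl⟩)
    · exact hxS v hv
    · refine eq_zero_of_collinearForm hξ hp.injOn (fun j hj1 hj2 => ?_) (hxS _ hp.start_mem)
        (hxS _ hp.end_mem) i (by omega)
      have hj := hp.notMem j hj1 hj2
      simpa only [hlp j hj1 hj2, hhp j hj1 hj2] using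
        hx (p j) (.inr ⟨j, ⟨hj1, hj2⟩, rfl⟩) (fun e => hj (e ▸ h₁)) (fun e => hj (e ▸ h₂))

/-- A 2-rooted graph admits a neighbour assignment determining all vertices from the roots. -/
theorem IsTwoRooted.exists_determines_univ {n : ℕ} {G : SimpleGraph (Fin n)} {r₁ r₂ : Fin n}
    (hroot : IsTwoRooted G r₁ r₂) {ξ : Fin n → ℂ} (hξ : Function.Injective ξ) :
    ∃ l h, Determines G ξ r₁ r₂ Set.univ l h := by
  have hbase : ∃ l h, Determines G ξ r₁ r₂ {r₁, r₂} l h := by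
    refine ⟨id, id, ?_, ?_⟩
    · rintro v (rfl | rfl) hv1 hv2 <;> contradiction
    · rintro x - hx1 hx2 v (rfl | rfl) <;> assumption
  let F : Set (Set (Fin n)) :=
    {S | r₁ ∈ S ∧ r₂ ∈ S ∧ ∃ l h, Determines G ξ r₁ r₂ S l h}
  obtain ⟨S, ⟨h₁, h₂, l, h, hdet⟩, hmax⟩ :=
    F.toFinite.exists_maximal ⟨_, by simp, by simp, hbase⟩
  by_cases hS : S = Set.univ
  · exact ⟨l, h, hS ▸ hdet⟩
  obtain ⟨v, hv⟩ := (Set.ne_univ_iff_exists_notMem S).mp hS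
  obtain ⟨k, p, hp⟩ := hroot.exists_isEar h₁ h₂ hv
  have hle := hmax (y := S ∪ p '' Set.Icc 1 k)
    ⟨.inl h₁, .inl h₂, hdet.exists_of_isEar hξ h₁ h₂ hp⟩ Set.subset_union_left
  exact absurd (hle (.inr ⟨1, ⟨le_rfl, hp.one_le⟩, rfl⟩)) (hp.notMem 1 le_rfl hp.one_le)

/-- A matrix killing `1` and `ξ` whose kernel is determined by two coordinates has corank `2`. -/
theorem rank_eq_sub_two {n : ℕ} {L : Matrix (Fin n) (Fin n) ℂ} {ξ : Fin n → ℂ} {r₁ r₂ : Fin n}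
    (hξ : ξ r₁ ≠ ξ r₂) (h1 : L.mulVec 1 = 0) (hLξ : L.mulVec ξ = 0)
    (hker : ∀ x, L.mulVec x = 0 → x r₁ = 0 → x r₂ = 0 → x = 0) : L.rank = n - 2 := by
  have hrn := L.mulVecLin.finrank_range_add_finrank_ker
  rw [Module.finrank_fin_fun] at hrn
  have hle : Module.finrank ℂ (LinearMap.ker L.mulVecLin) ≤ 2 := by
    let f : (Fin n → ℂ) →ₗ[ℂ] (Fin 2 → ℂ) := LinearMap.funLeft ℂ ℂ ![r₁, r₂]
    have hinj : Function.Injective (f.domRestrict (LinearMap.ker L.mulVecLin)) := by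
      rw [injective_iff_map_eq_zero]
      rintro ⟨x, hx⟩ hfx
      exact Subtype.ext (hker x hx (congrFun hfx 0) (congrFun hfx 1))
    simpa using LinearMap.finrank_le_finrank_of_injective hinj
  have hge : 2 ≤ Module.finrank ℂ (LinearMap.ker L.mulVecLin) := by
    have hli : LinearIndependent ℂ ![(1 : Fin n → ℂ), ξ] := by
      rw [LinearIndependent.pair_iff]
      intro s t hst
      have e1 : s + t * ξ r₁ = 0 := by simpa using congrFun hst r₁
      have e2 : s + t * ξ r₂ = 0 := by simpa using congrFun hst r₂
      have ht : t = 0 := by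
        have : t * (ξ r₁ - ξ r₂) = 0 := by linear_combination e1 - e2
        exact (mul_eq_zero.mp this).resolve_right (sub_ne_zero.mpr hξ)
      exact ⟨by simpa [ht] using e1, ht⟩
    have hspan : Submodule.span ℂ (Set.range ![(1 : Fin n → ℂ), ξ]) ≤
        LinearMap.ker L.mulVecLin := by
      rw [Submodule.span_le]
      rintro _ ⟨i, rfl⟩
      fin_cases i
      · exact h1
      · exact hLξ
    simpa [finrank_span_eq_card hli] using Submodule.finrank_mono hspan
  rw [Matrix.rank]
  omega

/-- If `G` is 2-rooted (`n ≥ 3`) and `ξ` has pairwise distinct entries, there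
exists a complex Laplacian `L` supported on `G` (zero entries off the edges, zero row sums,
so `L·𝟙 = 0`) with `L·ξ = 0` and `rank L = n - 2`. -/
theorem exists_complex_laplacian_of_two_rooted {n : ℕ} (hn : 3 ≤ n)
    (G : SimpleGraph (Fin n)) (r₁ r₂ : Fin n) (hroot : IsTwoRooted G r₁ r₂)
    (ξ : Fin n → ℂ) (hξ : ∀ i j : Fin n, i ≠ j → ξ i ≠ ξ j) :
    ∃ L : Matrix (Fin n) (Fin n) ℂ,
      (∀ i j : Fin n, i ≠ j → ¬ G.Adj i j → L i j = 0) ∧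
      (∀ i : Fin n, L i i = -∑ j ∈ Finset.univ.erase i, L i j) ∧
      L.mulVec 1 = 0 ∧ L.mulVec ξ = 0 ∧ L.rank = n - 2 := by
  classical
  have hinj : Function.Injective ξ := fun i j h => by_contra fun hij => hξ i j hij h
  obtain ⟨l, h, hadj, hdet⟩ := hroot.exists_determines_univ hinj
  let L : Matrix (Fin n) (Fin n) ℂ := fun i => if i = r₁ ∨ i = r₂ then 0 else
    Pi.single i (ξ (h i) - ξ (l i)) - Pi.single (l i) (ξ (h i) - ξ i)
      - Pi.single (h i) (ξ i - ξ (l i))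
  have hmul : ∀ x i, L.mulVec x i =
      if i = r₁ ∨ i = r₂ then 0 else collinearForm ξ i (l i) (h i) x := by
    intro x i
    simp only [Matrix.mulVec, L]
    split_ifs
    · exact zero_dotProduct x
    · simp only [sub_dotProduct, single_dotProduct, collinearForm]
  have h1 : L.mulVec 1 = 0 := by
    ext i
    rw [hmul]
    simp [collinearForm]
  have hLξ : L.mulVec ξ = 0 := by
    ext i
    rw [hmul, Pi.zero_apply, ite_eq_left_iff]
    intro _
    rw [collinearForm]
    ring
  refine ⟨L, fun i j hij hnadj => ?_, fun i => ?_, h1, hLξ,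
    rank_eq_sub_two (hξ r₁ r₂ hroot.1) h1 hLξ fun x hx hx1 hx2 => ?_⟩
  · simp only [L]
    split_ifs with hi
    · rfl
    · push Not at hi
      obtain ⟨hl, hh⟩ := hadj i trivial hi.1 hi.2
      have hjl : j ≠ l i := fun e => hnadj (e ▸ hl)
      have hjh : j ≠ h i := fun e => hnadj (e ▸ hh)
      simp [Pi.single_eq_of_ne hij.symm, Pi.single_eq_of_ne hjl, Pi.single_eq_of_ne hjh]
  · have hsum : ∑ j, L i j = 0 := by simpa [Matrix.mulVec, dotProduct] using congrFun h1 i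
    rw [← Finset.add_sum_erase _ _ (Finset.mem_univ i)] at hsum
    exact eq_neg_of_add_eq_zero_left hsum
  · funext v
    refine hdet x (fun v _ hv1 hv2 => ?_) hx1 hx2 v trivial
    have := congrFun hx v
    rwa [hmul, if_neg (not_or.mpr ⟨hv1, hv2⟩)] at this
end

section
/- Let G be a bidirectional (simple) graph on the vertex set {1,…,n} with n ≥ 3 that is NOT 2-rooted, and let ξ ∈ ℂⁿ have pairwise distinct entries. Then every n×n complex matrix L supported on G (i.e. L(i,j) = 0 whenever i ≠ j and {i,j} is not an edge of G, and each diagonal entry equals the negated sum of the off-diagonal entries of its row, so L·𝟙 = 0) satisfying L·ξ = 0 has rank(L) < n − 2. Hence 2-rootedness is necessary for the algebraic conditions L·ξ = 0 and rank(L) = n − 2 to be achievable. -/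
open Matrix

/-- If the rows of a matrix indexed by `C` are supported on `C ∪ {u}`, and both `𝟙`
and a vector `ξ` that is not constant on `C ∪ {u}` lie in the kernel, then these rows are
linearly dependent. -/
theorem not_linearIndependent_rows_of_support {ι K : Type*} [Fintype ι] [DecidableEq ι] [Field K]
    (L : Matrix ι ι K) (ξ : ι → K) (C : Finset ι) (u v : ι) (hv : v ∈ C)
    (huv : ξ v ≠ ξ u) (hsum : ∀ i, ∑ j, L i j = 0) (hker : L *ᵥ ξ = 0)
    (hsupp : ∀ i ∈ C, ∀ j ∉ C, j ≠ u → L i j = 0) :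
    ¬ LinearIndependent K (fun i : C => L.row i) := by
  intro hli
  have hdet : (L.submatrix (Subtype.val : C → ι) Subtype.val).det = 0 := by
    refine Matrix.exists_mulVec_eq_zero_iff.mp ⟨fun j => ξ j - ξ u, fun h => ?_, ?_⟩
    · exact huv (sub_eq_zero.mp (congrFun h ⟨v, hv⟩))
    · ext i
      have hzero : ∑ j, L i j * (ξ j - ξ u) = 0 := by
        have h := congrFun hker i
        simp only [Matrix.mulVec, dotProduct, Pi.zero_apply] at h
        simp only [mul_sub, Finset.sum_sub_distrib, h, ← Finset.sum_mul, hsum, zero_mul, sub_zero]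
      simp only [Matrix.mulVec, dotProduct, Matrix.submatrix_apply, Pi.zero_apply]
      rw [Finset.sum_coe_sort C (fun j => L i j * (ξ j - ξ u)), ← hzero]
      refine Finset.sum_subset (Finset.subset_univ C) fun j _ hj => ?_
      by_cases hju : j = u
      · simp [hju]
      · simp [hsupp i i.2 j hj hju]
  obtain ⟨y, hy, hyL⟩ := Matrix.exists_vecMul_eq_zero_iff.mpr hdet
  have hcol : ∀ j, j ≠ u → ∑ i : C, y i * L i j = 0 := by
    intro j hju
    by_cases hj : j ∈ C
    · exact congrFun hyL ⟨j, hj⟩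
    · exact Finset.sum_eq_zero fun i _ => by rw [hsupp i i.2 j hj hju, mul_zero]
  have htotal : ∑ j, ∑ i : C, y i * L i j = 0 := by
    rw [Finset.sum_comm]
    simp [← Finset.mul_sum, hsum]
  have hcolu : ∑ i : C, y i * L i u = 0 := by
    rwa [Finset.sum_eq_single u (fun j _ hj => hcol j hj) (by simp)] at htotal
  refine hy (funext (Fintype.linearIndependent_iff.mp hli y ?_))
  ext j
  simp only [Finset.sum_apply, Pi.smul_apply, Matrix.row_apply, smul_eq_mul, Pi.zero_apply]
  by_cases hju : j = u
  · rw [hju, hcolu]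
  · exact hcol j hju

/-- A matrix of rank at least `n - 2` (with `n ≥ 2`) has two distinct rows whose removal leaves
linearly independent rows. -/
theorem exists_pair_linearIndependent_rows {n : ℕ} {K : Type*} [Field K] (hn : 2 ≤ n)
    (L : Matrix (Fin n) (Fin n) K) (hL : n - 2 ≤ L.rank) :
    ∃ r₁ r₂ : Fin n, r₁ ≠ r₂ ∧
      LinearIndepOn K L.row {i | i ≠ r₁ ∧ i ≠ r₂} := by
  classical
  obtain ⟨s, hspan, hli⟩ : ∃ s : Set (Fin n),
      Submodule.span K (L.row '' s) = Submodule.span K (Set.range L.row) ∧ LinearIndepOn K L.row s := by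
    obtain ⟨κ, a, ha, hspan, hli⟩ := exists_linearIndependent' K L.row
    refine ⟨Set.range a, by rw [← hspan, ← Set.range_comp], ?_⟩
    exact (linearIndepOn_range_iff ha L.row).mpr hli
  have hcard : s.toFinset.card = L.rank := by
    have h := finrank_span_eq_card hli
    rw [Matrix.rank_eq_finrank_span_row, Set.toFinset_card, ← h, ← hspan,
      Set.image_eq_range]
  obtain ⟨T, hsT, hT⟩ := Finset.exists_superset_card_eq (s := s.toFinsetᶜ) (n := 2)
    (by rw [Finset.card_compl, Fintype.card_fin]; omega) (by simpa using hn)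
  obtain ⟨r₁, r₂, hr, rfl⟩ := Finset.card_eq_two.mp hT
  refine ⟨r₁, r₂, hr, hli.mono fun i hi => ?_⟩
  by_contra his
  have hmem := hsT (show i ∈ s.toFinsetᶜ by simpa using his)
  simp only [Finset.mem_insert, Finset.mem_singleton] at hmem
  exact hmem.elim hi.1 hi.2

/-- If `G` is not 2-rooted (`n ≥ 3`) and `ξ` has pairwise distinct entries,
then every complex Laplacian `L` supported on `G` (zero entries off the edges, zero row
sums, so `L·𝟙 = 0`) satisfying `L·ξ = 0` has `rank L < n - 2`: 2-rootedness is necessary. -/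
theorem rank_lt_of_not_two_rooted {n : ℕ} (hn : 3 ≤ n) (G : SimpleGraph (Fin n))
    (hroot : ¬ ∃ r₁ r₂ : Fin n, IsTwoRooted G r₁ r₂)
    (ξ : Fin n → ℂ) (hξ : ∀ i j : Fin n, i ≠ j → ξ i ≠ ξ j) :
    ∀ L : Matrix (Fin n) (Fin n) ℂ,
      (∀ i j : Fin n, i ≠ j → ¬ G.Adj i j → L i j = 0) →
      (∀ i : Fin n, L i i = -∑ j ∈ Finset.univ.erase i, L i j) →
      L.mulVec ξ = 0 → L.rank < n - 2 := by
  classical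
  intro L hadj hdiag hker
  by_contra hrank
  obtain ⟨r₁, r₂, hr, hli⟩ := exists_pair_linearIndependent_rows (by omega) L (not_lt.mp hrank)
  refine hroot ⟨r₁, r₂, hr, fun v _ _ u huv => ?_⟩
  by_contra hunreach
  let C : Finset (Fin n) := Finset.univ.filter fun w =>
    ∃ hw : w ≠ u, (G.induce {w : Fin n | w ≠ u}).Reachable ⟨w, hw⟩ ⟨v, huv.symm⟩
  have hCroots : (C : Set (Fin n)) ⊆ {i | i ≠ r₁ ∧ i ≠ r₂} := by
    intro i hi
    have hi' := (Finset.mem_filter.mp (Finset.mem_coe.mp hi)).2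
    exact ⟨fun h => hunreach ⟨i, Or.inl h, hi'⟩, fun h => hunreach ⟨i, Or.inr h, hi'⟩⟩
  have hsum : ∀ i, ∑ j, L i j = 0 := fun i => by
    rw [← Finset.add_sum_erase _ _ (Finset.mem_univ i), hdiag i, neg_add_cancel]
  refine not_linearIndependent_rows_of_support L ξ C u v
    (Finset.mem_filter.mpr ⟨Finset.mem_univ v, huv.symm, SimpleGraph.Reachable.refl _⟩)
    (hξ v u huv.symm) hsum hker (fun i hi j hj hju => ?_) (hli.mono hCroots)
  obtain ⟨hiu, hreach⟩ := (Finset.mem_filter.mp hi).2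
  refine hadj i j (fun h => hj (h ▸ hi)) fun hij => ?_
  refine hj (Finset.mem_filter.mpr ⟨Finset.mem_univ j, hju, SimpleGraph.Reachable.trans ?_ hreach⟩)
  exact SimpleGraph.Adj.reachable (SimpleGraph.comap_adj.mpr hij.symm)
end
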